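/- There exists a smooth map G : ℝ × (ℝⁿ)^{2k} → ℝⁿ, depending only on L, such that for every smooth curve φ : ℝ → ℝⁿ and every t ∈ ℝ, the Euler–Lagrange expression decomposes as Σ_{i=0}^{k} (−1)^i (dⁱ/dtⁱ)[(∂L/∂q_i) ∘ j^kφ](t) = (−1)^k W(j^kφ(t)) · φ^{(2k)}(t) + G(j^{2k−1}φ(t)). Consequently, if L is regular (W invertible everywhere), a smooth curve φ satisfies the k-th order Euler–Lagrange equation if and only if it satisfies the explicit 2k-th order ODE φ^{(2k)}(t) = (−1)^{k+1} W(j^kφ(t))^{−1} G(j^{2k−1}φ(t)); in particular the Euler–Lagrange dynamics of a regular Lagrangian is governed by a unique semispray of type 1. -/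

import Mathlib

open scoped ContDiff RealInnerProductSpace

noncomputable section

/-- `ℝⁿ` as a Euclidean space. -/
abbrev Evec (n : ℕ) := EuclideanSpace ℝ (Fin n)

/-- The partial gradient `∂f/∂q_i` of a function `f : ℝ × (ℝⁿ)^N → ℝ`
with respect to the variable `q_i`. -/
noncomputable def pgradN {n N : ℕ} (f : ℝ × (Fin N → Evec n) → ℝ)
    (i : Fin N) (x : ℝ × (Fin N → Evec n)) : Evec n :=
  gradient (fun v => f (x.1, Function.update x.2 i v)) (x.2 i)

/-- The total time derivative `d_T f = ∂f/∂t + ∑_i q_{i+1} · ∂f/∂q_i` of a function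
on `ℝ × (ℝⁿ)^N` (functions of `(t, q_0, …, q_m)` are regarded as functions on this
space, not depending on the higher variables, for which the extra terms vanish). -/
noncomputable def dT {n N : ℕ} {F : Type*} [NormedAddCommGroup F] [NormedSpace ℝ F]
    (f : ℝ × (Fin N → Evec n) → F) : ℝ × (Fin N → Evec n) → F :=
  fun x => deriv (fun s => f (s, x.2)) x.1 +
    ∑ i : Fin N, if h : (i : ℕ) + 1 < N then
      fderiv ℝ (fun v => f (x.1, Function.update x.2 i v)) (x.2 i) (x.2 ⟨(i : ℕ)+1, h⟩)
    else 0

/-- A `k`-th order Lagrangian regarded as a function on `ℝ × (ℝⁿ)^N`, `k+1 ≤ N`. -/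
def extendL {n k N : ℕ} (h : k + 1 ≤ N) (L : ℝ × (Fin (k+1) → Evec n) → ℝ) :
    ℝ × (Fin N → Evec n) → ℝ :=
  fun x => L (x.1, fun i => x.2 ⟨(i : ℕ), by have := i.isLt; omega⟩)

/-- The Jacobi–Ostrogradsky momentum function
`p̂^{r-1} = ∑_{i=0}^{k-r} (-1)^i d_T^i (∂L/∂q_{r+i})`, as a function on `ℝ × (ℝⁿ)^N`. -/
noncomputable def hatP {n k N : ℕ} (h : k + 1 ≤ N) (L : ℝ × (Fin (k+1) → Evec n) → ℝ)
    (r : ℕ) (hr1 : 1 ≤ r) (hrk : r ≤ k) : ℝ × (Fin N → Evec n) → Evec n :=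
  fun x => ∑ i : Fin (k - r + 1),
    ((-1:ℝ)^(i : ℕ)) •
      (dT^[(i : ℕ)] (pgradN (extendL h L) ⟨r + (i : ℕ), by have := i.isLt; omega⟩)) x

/-- The Hessian matrix `W` of a `k`-th order Lagrangian with respect to the highest
velocity variable `q_k`: `W A B = ∂²L/∂q_k^B ∂q_k^A`. -/
noncomputable def hessQk {n k : ℕ} (L : ℝ × (Fin (k+1) → Evec n) → ℝ)
    (x : ℝ × (Fin (k+1) → Evec n)) : Matrix (Fin n) (Fin n) ℝ :=
  fun A B =>
    fderiv ℝ (fun v => gradient (fun w => L (x.1, Function.update x.2 (Fin.last k) w)) v A)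
      (x.2 (Fin.last k)) (EuclideanSpace.single B 1)

/-- The restricted Legendre–Ostrogradsky map
`FL(t, q_0, …, q_{2k-1}) = (t, q_0, …, q_{k-1}, p̂^0, …, p̂^{k-1})`. -/
noncomputable def legendreFL {n k : ℕ} (hk : 1 ≤ k) (L : ℝ × (Fin (k+1) → Evec n) → ℝ) :
    ℝ × (Fin (2*k) → Evec n) → ℝ × (Fin (2*k) → Evec n) :=
  fun x => (x.1, fun j => if h : (j : ℕ) < k then x.2 ⟨(j : ℕ), by omega⟩
    else hatP (by omega) L ((j : ℕ) - k + 1) (by omega)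
      (by have := j.isLt; omega) x)

/-- Truncation of a point of `ℝ × (ℝⁿ)^{2k}` to a point of `ℝ × (ℝⁿ)^{k+1}`. -/
def truncK {n k : ℕ} (hk : 1 ≤ k) (w : ℝ × (Fin (2*k) → Evec n)) :
    ℝ × (Fin (k+1) → Evec n) :=
  (w.1, fun i => w.2 ⟨(i : ℕ), by have := i.isLt; omega⟩)


/-- The jet prolongation `t ↦ (t, φ(t), φ'(t), …, φ^{(N-1)}(t))` of a curve `φ : ℝ → ℝⁿ`. -/
noncomputable def jetN {n : ℕ} (N : ℕ) (φ : ℝ → Evec n) (t : ℝ) :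
    ℝ × (Fin N → Evec n) := (t, fun i => iteratedDeriv (i : ℕ) φ t)

/-- Action of an `n × n` matrix on a vector of `ℝⁿ`. -/
noncomputable def mvE {n : ℕ} (M : Matrix (Fin n) (Fin n) ℝ) (v : Evec n) : Evec n :=
  (EuclideanSpace.equiv (Fin n) ℝ).symm (M.mulVec (EuclideanSpace.equiv (Fin n) ℝ v))

section JetFunctions

variable {n : ℕ} {F : Type*} [NormedAddCommGroup F] [NormedSpace ℝ F]

/-- A differential operator `φ ↦ (t ↦ g φ t)` which is a smooth function of
`(t, φ(t), …, φ^{(N-1)}(t))` on smooth curves. -/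
def IsJetFunction (N : ℕ) (g : (ℝ → Evec n) → ℝ → F) : Prop :=
  ∃ G : ℝ × (Fin N → Evec n) → F, ContDiff ℝ ∞ G ∧
    ∀ φ, ContDiff ℝ ∞ φ → ∀ t, g φ t = G (jetN N φ t)

lemma hasDerivAt_iteratedDeriv {φ : ℝ → F} (hφ : ContDiff ℝ ∞ φ) (m : ℕ) (t : ℝ) :
    HasDerivAt (iteratedDeriv m φ) (iteratedDeriv (m + 1) φ t) t := by
  rw [iteratedDeriv_succ]
  exact (hφ.differentiable_iteratedDeriv m (by exact_mod_cast ENat.natCast_lt_top m)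
    t).hasDerivAt

lemma hasDerivAt_jetN (N : ℕ) {φ : ℝ → Evec n} (hφ : ContDiff ℝ ∞ φ) (t : ℝ) :
    HasDerivAt (jetN N φ) ((1 : ℝ), fun i : Fin N => iteratedDeriv ((i : ℕ) + 1) φ t) t :=
  (hasDerivAt_id t).prodMk (hasDerivAt_pi.2 fun i => hasDerivAt_iteratedDeriv hφ i t)

lemma hasDerivAt_comp_jetN {N : ℕ} {G : ℝ × (Fin N → Evec n) → F} (hG : ContDiff ℝ ∞ G)
    {φ : ℝ → Evec n} (hφ : ContDiff ℝ ∞ φ) (t : ℝ) :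
    HasDerivAt (fun s => G (jetN N φ s))
      (fderiv ℝ G (jetN N φ t) ((1 : ℝ), fun i : Fin N => iteratedDeriv ((i : ℕ) + 1) φ t)) t :=
  ((hG.differentiable (by simp) _).hasFDerivAt).comp_hasDerivAt t (hasDerivAt_jetN N hφ t)

lemma IsJetFunction.differentiable {N : ℕ} {g : (ℝ → Evec n) → ℝ → F}
    (hg : IsJetFunction N g) {φ : ℝ → Evec n} (hφ : ContDiff ℝ ∞ φ) :
    Differentiable ℝ (g φ) := by
  obtain ⟨G, hG, h⟩ := hg
  rw [show g φ = fun s => G (jetN N φ s) from funext (h φ hφ)]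
  exact fun t => (hasDerivAt_comp_jetN hG hφ t).differentiableAt

lemma IsJetFunction.congr {N : ℕ} {g g' : (ℝ → Evec n) → ℝ → F} (hg : IsJetFunction N g)
    (h : ∀ φ, ContDiff ℝ ∞ φ → ∀ t, g' φ t = g φ t) : IsJetFunction N g' := by
  obtain ⟨G, hG, hg⟩ := hg
  exact ⟨G, hG, fun φ hφ t => (h φ hφ t).trans (hg φ hφ t)⟩

lemma IsJetFunction.mono {N M : ℕ} (hNM : N ≤ M) {g : (ℝ → Evec n) → ℝ → F}
    (hg : IsJetFunction N g) : IsJetFunction M g := by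
  obtain ⟨G, hG, hg⟩ := hg
  refine ⟨fun x => G (x.1, fun i => x.2 (Fin.castLE hNM i)), hG.comp ?_, hg⟩
  fun_prop

lemma IsJetFunction.add {N : ℕ} {g g' : (ℝ → Evec n) → ℝ → F} (hg : IsJetFunction N g)
    (hg' : IsJetFunction N g') : IsJetFunction N (fun φ t => g φ t + g' φ t) := by
  obtain ⟨G, hG, hg⟩ := hg
  obtain ⟨G', hG', hg'⟩ := hg'
  exact ⟨fun x => G x + G' x, hG.add hG', fun φ hφ t => by simp only [hg φ hφ, hg' φ hφ]⟩

lemma IsJetFunction.const_smul {N : ℕ} {g : (ℝ → Evec n) → ℝ → F} (c : ℝ)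
    (hg : IsJetFunction N g) : IsJetFunction N (fun φ t => c • g φ t) := by
  obtain ⟨G, hG, hg⟩ := hg
  exact ⟨fun x => c • G x, contDiff_const.smul hG, fun φ hφ t => by simp only [hg φ hφ]⟩

lemma IsJetFunction.sum {N : ℕ} {ι : Type*} (s : Finset ι) {g : ι → (ℝ → Evec n) → ℝ → F}
    (hg : ∀ i, IsJetFunction N (g i)) : IsJetFunction N (fun φ t => ∑ i ∈ s, g i φ t) := by
  choose G hG hg using hg
  exact ⟨fun x => ∑ i ∈ s, G i x, ContDiff.sum fun i _ => hG i,
    fun φ hφ t => Finset.sum_congr rfl fun i _ => hg i φ hφ t⟩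

lemma IsJetFunction.clm_apply {N : ℕ} {A : (ℝ → Evec n) → ℝ → (Evec n →L[ℝ] F)}
    {v : (ℝ → Evec n) → ℝ → Evec n} (hA : IsJetFunction N A) (hv : IsJetFunction N v) :
    IsJetFunction N (fun φ t => A φ t (v φ t)) := by
  obtain ⟨A', hA', hA⟩ := hA
  obtain ⟨v', hv', hv⟩ := hv
  exact ⟨fun x => A' x (v' x), hA'.clm_apply hv', fun φ hφ t => by simp only [hA φ hφ, hv φ hφ]⟩

lemma isJetFunction_iteratedDeriv {m N : ℕ} (h : m < N) :
    IsJetFunction N (fun (φ : ℝ → Evec n) t => iteratedDeriv m φ t) :=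
  ⟨fun x => x.2 ⟨m, h⟩, by fun_prop, fun _ _ _ => rfl⟩

lemma IsJetFunction.deriv {N : ℕ} {g : (ℝ → Evec n) → ℝ → F} (hg : IsJetFunction N g) :
    IsJetFunction (N + 1) (fun φ t => deriv (g φ) t) := by
  obtain ⟨G, hG, h⟩ := hg
  refine ⟨fun x => fderiv ℝ G (x.1, fun i => x.2 i.castSucc) ((1 : ℝ), fun i => x.2 i.succ),
    ?_, fun φ hφ t => ?_⟩
  · refine ContDiff.clm_apply ((hG.fderiv_right (m := ∞) (by simp)).comp ?_) ?_ <;> fun_prop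
  · beta_reduce
    rw [show g φ = fun s => G (jetN N φ s) from funext (h φ hφ),
      (hasDerivAt_comp_jetN hG hφ t).deriv]
    rfl

lemma IsJetFunction.iteratedDeriv {N : ℕ} {g : (ℝ → Evec n) → ℝ → F} (hg : IsJetFunction N g)
    (i : ℕ) : IsJetFunction (N + i) (fun φ t => iteratedDeriv i (g φ) t) := by
  induction i with
  | zero => simpa using hg
  | succ i ih => exact ih.deriv.congr fun φ _ t => by rw [iteratedDeriv_succ]

/-- The partial derivative with respect to the `i`-th jet variable. -/
def pderivN {N : ℕ} (f : ℝ × (Fin N → Evec n) → F) (i : Fin N)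
    (x : ℝ × (Fin N → Evec n)) : Evec n →L[ℝ] F :=
  (fderiv ℝ f x).comp ((ContinuousLinearMap.inr ℝ ℝ (Fin N → Evec n)).comp
    (ContinuousLinearMap.single ℝ (fun _ : Fin N => Evec n) i))

lemma contDiff_pderivN {N : ℕ} {f : ℝ × (Fin N → Evec n) → F} (hf : ContDiff ℝ ∞ f)
    (i : Fin N) : ContDiff ℝ ∞ (pderivN f i) :=
  (hf.fderiv_right (m := ∞) (by simp)).clm_comp contDiff_const

lemma hasFDerivAt_update_single {N : ℕ} (x : Fin N → Evec n) (i : Fin N) (v : Evec n) :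
    HasFDerivAt (Function.update x i)
      (ContinuousLinearMap.single ℝ (fun _ : Fin N => Evec n) i) v := by
  refine (hasFDerivAt_update x v).congr_fderiv (ContinuousLinearMap.ext fun w => ?_)
  ext1 j
  obtain rfl | h := eq_or_ne j i <;> simp [*]

lemma hasFDerivAt_comp_update {N : ℕ} {f : ℝ × (Fin N → Evec n) → F} (hf : ContDiff ℝ ∞ f)
    (i : Fin N) (x : ℝ × (Fin N → Evec n)) (v : Evec n) :
    HasFDerivAt (fun w => f (x.1, Function.update x.2 i w))
      (pderivN f i (x.1, Function.update x.2 i v)) v :=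
  (hf.differentiable (by simp) _).hasFDerivAt.comp v
    ((hasFDerivAt_prodMk_right x.1 _).comp v (hasFDerivAt_update_single x.2 i v))

/-- The `r`-th total derivative of a function of `(t, φ, …, φ^{(k)})`, `r ≥ 1`, is affine in
`φ^{(k+r)}` with leading coefficient the partial derivative in the last variable. -/
lemma isJetFunction_iteratedDeriv_sub_pderivN {k : ℕ} {f : ℝ × (Fin (k + 1) → Evec n) → F}
    (hf : ContDiff ℝ ∞ f) (r : ℕ) :
    IsJetFunction (k + (r + 1)) (fun φ t =>
      iteratedDeriv (r + 1) (fun s => f (jetN (k + 1) φ s)) t -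
        pderivN f (Fin.last k) (jetN (k + 1) φ t) (iteratedDeriv (k + (r + 1)) φ t)) := by
  induction r with
  | zero =>
    refine ⟨fun x => fderiv ℝ f x
      ((1 : ℝ), Fin.snoc (α := fun _ => Evec n) (fun i : Fin k => x.2 i.succ) 0), ?_,
      fun φ hφ t => ?_⟩
    · refine ContDiff.clm_apply (hf.fderiv_right (m := ∞) (by simp)) (contDiff_const.prodMk ?_)
      refine contDiff_pi.2 fun i => ?_
      induction i using Fin.lastCases with
      | last => simpa using contDiff_const
      | cast i => simp only [Fin.snoc_castSucc]; fun_prop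
    · simp only [zero_add]
      rw [iteratedDeriv_one, (hasDerivAt_comp_jetN hf hφ t).deriv, pderivN,
        ContinuousLinearMap.comp_apply, ← map_sub]
      congr 1
      refine Prod.ext (by simp) (funext fun i => ?_)
      induction i using Fin.lastCases with
      | last => simp
      | cast i => simp [jetN, i.castSucc_ne_last]
  | succ r ih =>
    have hA : IsJetFunction (k + 1)
        (fun φ t => pderivN f (Fin.last k) (jetN (k + 1) φ t)) :=
      ⟨_, contDiff_pderivN hf _, fun _ _ _ => rfl⟩
    refine (ih.deriv.add ((hA.deriv.mono (M := k + (r + 1) + 1) (by omega)).clm_apply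
      (isJetFunction_iteratedDeriv (m := k + (r + 1)) (by omega)))).congr fun φ hφ t => ?_
    have h₁ := (hA.differentiable hφ t).hasDerivAt.clm_apply
      (hasDerivAt_iteratedDeriv hφ (k + (r + 1)) t)
    have h₂ := (ih.differentiable hφ t).hasDerivAt.add h₁
    rw [iteratedDeriv_succ, sub_eq_iff_eq_add, add_assoc]
    refine Eq.trans ?_ h₂.deriv
    congr 1
    ext s
    simp

end JetFunctions

section Hessian

variable {n : ℕ}

lemma pgradN_eq {N : ℕ} {f : ℝ × (Fin N → Evec n) → ℝ} (hf : ContDiff ℝ ∞ f) (i : Fin N)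
    (x : ℝ × (Fin N → Evec n)) :
    pgradN f i x = (InnerProductSpace.toDual ℝ (Evec n)).symm (pderivN f i x) := by
  rw [pgradN, gradient, (hasFDerivAt_comp_update hf i x _).fderiv, Function.update_eq_self]

lemma contDiff_pgradN {N : ℕ} {f : ℝ × (Fin N → Evec n) → ℝ} (hf : ContDiff ℝ ∞ f)
    (i : Fin N) : ContDiff ℝ ∞ (pgradN f i) := by
  rw [funext (pgradN_eq hf i)]
  exact (InnerProductSpace.toDual ℝ (Evec n)).symm.toContinuousLinearEquiv.contDiff.comp
    (contDiff_pderivN hf i)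

lemma hessQk_apply {k : ℕ} {L : ℝ × (Fin (k + 1) → Evec n) → ℝ} (hL : ContDiff ℝ ∞ L)
    (x : ℝ × (Fin (k + 1) → Evec n)) (A B : Fin n) :
    hessQk L x A B =
      pderivN (pgradN L (Fin.last k)) (Fin.last k) x (EuclideanSpace.single B 1) A := by
  have h := hasFDerivAt_comp_update (contDiff_pgradN hL (Fin.last k)) (Fin.last k) x
    (x.2 (Fin.last k))
  simp only [pgradN, Function.update_idem, Function.update_self] at h
  have h' := ((EuclideanSpace.proj A : Evec n →L[ℝ] ℝ).hasFDerivAt).comp _ h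
  rw [Function.update_eq_self] at h'
  exact congrArg (fun l => l (EuclideanSpace.single B 1)) h'.fderiv

lemma mvE_hessQk {k : ℕ} {L : ℝ × (Fin (k + 1) → Evec n) → ℝ} (hL : ContDiff ℝ ∞ L)
    (x : ℝ × (Fin (k + 1) → Evec n)) (v : Evec n) :
    mvE (hessQk L x) v = pderivN (pgradN L (Fin.last k)) (Fin.last k) x v := by
  ext A
  have hv : v = ∑ B, v B • EuclideanSpace.single B (1 : ℝ) := by
    ext C; simp [Finset.sum_apply, Pi.single_apply]
  conv_rhs => rw [hv]
  simp [mvE, Matrix.mulVec, dotProduct, hessQk_apply hL, mul_comm]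

end Hessian

lemma mvE_mul {n : ℕ} (M N : Matrix (Fin n) (Fin n) ℝ) (v : Evec n) :
    mvE (M * N) v = mvE M (mvE N v) := by
  simp [mvE, ← Matrix.mulVec_mulVec]
  rfl

lemma mvE_one {n : ℕ} (v : Evec n) : mvE 1 v = v := by simp [mvE]

lemma mvE_smul {n : ℕ} (M : Matrix (Fin n) (Fin n) ℝ) (c : ℝ) (v : Evec n) :
    mvE M (c • v) = c • mvE M v := by
  simp [mvE, Matrix.mulVec_smul]

lemma smul_mvE_add_eq_zero_iff {n : ℕ} {M : Matrix (Fin n) (Fin n) ℝ} (hM : M.det ≠ 0) (k : ℕ)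
    (v w : Evec n) :
    ((-1 : ℝ) ^ k) • mvE M v + w = 0 ↔ v = ((-1 : ℝ) ^ (k + 1)) • mvE M⁻¹ w := by
  have hu : IsUnit M.det := isUnit_iff_ne_zero.2 hM
  have hs : ((-1 : ℝ) ^ k) * (-1) ^ k = 1 := by rw [← mul_pow]; simp
  constructor
  · intro h
    rw [eq_neg_of_add_eq_zero_right h, ← neg_smul, mvE_smul, ← mvE_mul,
      Matrix.nonsing_inv_mul _ hu, mvE_one, smul_smul, pow_succ]
    simp [hs]
  · rintro rfl
    rw [mvE_smul, ← mvE_mul, Matrix.mul_nonsing_inv _ hu, mvE_one, smul_smul, pow_succ,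
      ← mul_assoc, hs]
    simp


/-- There is a smooth map `G`, depending only on `L`, such that the
Euler–Lagrange expression of any smooth curve `φ` decomposes as
`∑ (-1)^i (dⁱ/dtⁱ)[(∂L/∂q_i) ∘ j^kφ] = (-1)^k W(j^kφ)·φ^{(2k)} + G(j^{2k-1}φ)`;
hence for regular `L` the Euler–Lagrange equation is equivalent to the explicit `2k`-th
order ODE `φ^{(2k)} = (-1)^{k+1} W(j^kφ)⁻¹ G(j^{2k-1}φ)`. -/
theorem stmt7 (n k : ℕ) (hn : 1 ≤ n) (hk : 1 ≤ k)
    (L : ℝ × (Fin (k+1) → Evec n) → ℝ) (hL : ContDiff ℝ ∞ L) :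
    ∃ G : ℝ × (Fin (2*k) → Evec n) → Evec n, ContDiff ℝ ∞ G ∧
      (∀ φ : ℝ → Evec n, ContDiff ℝ ∞ φ → ∀ t : ℝ,
        (∑ i : Fin (k+1), ((-1:ℝ)^(i : ℕ)) •
            iteratedDeriv (i : ℕ) (fun s => pgradN L i (jetN (k+1) φ s)) t)
          = ((-1:ℝ)^k) • mvE (hessQk L (jetN (k+1) φ t)) (iteratedDeriv (2*k) φ t)
            + G (jetN (2*k) φ t)) ∧
      ((∀ x : ℝ × (Fin (k+1) → Evec n), (hessQk L x).det ≠ 0) →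
        ∀ φ : ℝ → Evec n, ContDiff ℝ ∞ φ →
        ((∀ t, (∑ i : Fin (k+1), ((-1:ℝ)^(i : ℕ)) •
            iteratedDeriv (i : ℕ) (fun s => pgradN L i (jetN (k+1) φ s)) t) = 0)
          ↔ (∀ t, iteratedDeriv (2*k) φ t =
              ((-1:ℝ)^(k+1)) •
                mvE (hessQk L (jetN (k+1) φ t))⁻¹ (G (jetN (2*k) φ t))))) := by
  have key : IsJetFunction (2 * k) (fun φ t =>
      (∑ i : Fin (k+1), ((-1:ℝ)^(i : ℕ)) •
          iteratedDeriv (i : ℕ) (fun s => pgradN L i (jetN (k+1) φ s)) t)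
        - ((-1:ℝ)^k) • mvE (hessQk L (jetN (k+1) φ t)) (iteratedDeriv (2*k) φ t)) := by
    have hlow (i : Fin k) : IsJetFunction (2 * k) (fun φ t => ((-1 : ℝ) ^ (i : ℕ)) •
        iteratedDeriv (i : ℕ) (fun s => pgradN L i.castSucc (jetN (k + 1) φ s)) t) := by
      have h : IsJetFunction (k + 1) (fun φ t => pgradN L i.castSucc (jetN (k + 1) φ t)) :=
        ⟨_, contDiff_pgradN hL _, fun _ _ _ => rfl⟩
      exact ((h.iteratedDeriv i).mono (by omega)).const_smul _
    have htop := isJetFunction_iteratedDeriv_sub_pderivN (contDiff_pgradN hL (Fin.last k)) (k - 1)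
    rw [Nat.sub_add_cancel hk, ← two_mul] at htop
    refine ((IsJetFunction.sum Finset.univ hlow).add (htop.const_smul ((-1) ^ k))).congr
      fun φ _ t => ?_
    rw [Fin.sum_univ_castSucc, mvE_hessQk hL, smul_sub, ← add_sub_assoc]
    rfl
  obtain ⟨G, hG, hdec⟩ := key
  have hdec' := fun φ hφ t => sub_eq_iff_eq_add'.1 (hdec φ hφ t)
  refine ⟨G, hG, hdec', fun hreg φ hφ => forall_congr' fun t => ?_⟩
  rw [hdec' φ hφ t]
  exact smul_mvE_add_eq_zero_iff (hreg _) k _ _
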